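/- For α > -1, ρ > 0 and k ≥ 0, the Laguerre functions satisfy the Hankel-transform invariance ∫_0^∞ r^{α+1} L_k^{(α)}(r²) e^{-r²/2} J_α(ρ r) dr = (-1)^k ρ^α L_k^{(α)}(ρ²) e^{-ρ²/2}, where J_α is the Bessel function of the first kind of order α. -/

import Mathlib

open MeasureTheory Real

/-- Generalized Laguerre polynomial `L_k^{(α)}(z) = ∑_{j=0}^k (α+j+1)_{k-j}/((k-j)! j!) (-z)^j`. -/
noncomputable def laguerre (α : ℝ) (k : ℕ) (z : ℝ) : ℝ :=
  ∑ j ∈ Finset.range (k + 1),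
    Real.Gamma (α + k + 1) /
      (Real.Gamma (α + j + 1) * ((k - j).factorial : ℝ) * (j.factorial : ℝ)) * (-z) ^ j


/-- Bessel function of the first kind of real order `α`:
`J_α(z) = ∑_{m≥0} (-1)^m/(m! Γ(m+α+1)) (z/2)^{2m+α}`. -/
noncomputable def besselJ (α : ℝ) (z : ℝ) : ℝ :=
  ∑' m : ℕ, (-1 : ℝ) ^ m / ((m.factorial : ℝ) * Real.Gamma ((m : ℝ) + α + 1)) *
    (z / 2) ^ (2 * m) * (z / 2) ^ α

theorem sum_choose_mul_succ {R : Type*} [CommSemiring R] (f : ℕ → R) (n : ℕ) :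
    ∑ i ∈ Finset.range (n + 2), ((n + 1).choose i : R) * f i
      = ∑ i ∈ Finset.range (n + 1), (n.choose i : R) * (f i + f (i + 1)) := by
  rw [Finset.sum_choose_succ_mul (fun i _ => f i) n, ← Finset.sum_add_distrib]
  simp only [mul_add]

/-- The Chu–Vandermonde expansion of a rising factorial, written as a quotient of Gamma values,
in terms of falling factorials. -/
theorem Gamma_add_add_div_Gamma_eq_sum {a : ℝ} (ha : 0 < a) (m j : ℕ) :
    Gamma (a + m + j) / Gamma (a + m)
      = ∑ i ∈ Finset.range (j + 1),
          (j.choose i : ℝ) * (Gamma (a + j) / Gamma (a + i) * (m.descFactorial i : ℝ)) := by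
  have gpos (n : ℕ) : 0 < Gamma (a + n) := Gamma_pos_of_pos (by positivity)
  have gsucc (n : ℕ) : Gamma (a + (n + 1 : ℕ)) = (a + n) * Gamma (a + n) := by
    rw [Nat.cast_succ, ← add_assoc, Gamma_add_one (by positivity)]
  induction j with
  | zero => simp [(gpos m).ne', (Gamma_pos_of_pos ha).ne']
  | succ j ih =>
    have hm : Gamma (a + m + (j + 1 : ℕ)) = (a + m + j) * Gamma (a + m + j) := by
      rw [Nat.cast_succ, ← add_assoc, Gamma_add_one (by positivity)]
    have desc (i : ℕ) : (m.descFactorial (i + 1) : ℝ) = (m - i) * m.descFactorial i := by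
      rw [Nat.descFactorial_succ]
      rcases le_or_gt i m with h | h
      · push_cast [h]; ring
      · simp [Nat.descFactorial_eq_zero_iff_lt.2 h]
    set u : ℕ → ℝ := fun i => (m.descFactorial i : ℝ) / Gamma (a + i) with hu
    have hD (i : ℕ) : (m - i) * u i = (a + i) * u (i + 1) := by
      simp only [hu, gsucc, desc]
      have := (gpos i).ne'
      have : a + i ≠ 0 := by positivity
      field_simp
    have shift : ∑ i ∈ Finset.range (j + 1), (j.choose i : ℝ) * (i * u i)
        = ∑ i ∈ Finset.range (j + 1), (j.choose i : ℝ) * ((j - i) * u (i + 1)) := by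
      rw [Finset.sum_range_succ', Finset.sum_range_succ]
      simp only [Nat.cast_zero, zero_mul, mul_zero, add_zero, sub_self]
      refine Finset.sum_congr rfl fun i hi => ?_
      have hij : i ≤ j := (Finset.mem_range.1 hi).le
      have h := congrArg (Nat.cast : ℕ → ℝ) (Nat.choose_succ_right_eq j i)
      push_cast [hij] at h ⊢
      linear_combination u (i + 1) * h
    have ih' : Gamma (a + m + j) / Gamma (a + m)
        = Gamma (a + j) * ∑ i ∈ Finset.range (j + 1), (j.choose i : ℝ) * u i := by
      rw [ih, Finset.mul_sum]
      exact Finset.sum_congr rfl fun i _ => by simp only [hu]; ring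
    have step : (a + m + j) * ∑ i ∈ Finset.range (j + 1), (j.choose i : ℝ) * u i
        = (a + j) * ∑ i ∈ Finset.range (j + 1), (j.choose i : ℝ) * (u i + u (i + 1)) := by
      rw [← sub_eq_zero] at shift ⊢
      rw [← shift]
      simp only [Finset.mul_sum, ← Finset.sum_sub_distrib]
      refine Finset.sum_congr rfl fun i _ => ?_
      linear_combination (j.choose i : ℝ) * hD i
    calc _ = (a + m + j) * (Gamma (a + m + j) / Gamma (a + m)) := by rw [hm]; ring
      _ = Gamma (a + j) * ((a + m + j) *
            ∑ i ∈ Finset.range (j + 1), (j.choose i : ℝ) * u i) := by rw [ih']; ring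
      _ = Gamma (a + (j + 1 : ℕ)) *
            ∑ i ∈ Finset.range (j + 1), (j.choose i : ℝ) * (u i + u (i + 1)) := by
          rw [step, gsucc]; ring
      _ = _ := by
          rw [← sum_choose_mul_succ, Finset.mul_sum]
          exact Finset.sum_congr rfl fun i _ => by simp only [hu]; ring

theorem hasSum_pow_div_factorial_mul_descFactorial (y : ℝ) (i : ℕ) :
    HasSum (fun m : ℕ => y ^ m / (m.factorial : ℝ) * (m.descFactorial i : ℝ))
      (y ^ i * Real.exp y) := by
  rw [← hasSum_nat_add_iff' i, Finset.sum_eq_zero, sub_zero]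
  · have h := (NormedSpace.expSeries_div_hasSum_exp y).mul_left (y ^ i)
    rw [← Real.exp_eq_exp_ℝ] at h
    convert! h using 2 with m
    have hf := congrArg (Nat.cast : ℕ → ℝ) (Nat.factorial_mul_descFactorial (Nat.le_add_left i m))
    rw [Nat.add_sub_cancel] at hf
    push_cast at hf
    rw [← hf, pow_add]
    have : ((m + i).descFactorial i : ℝ) ≠ 0 := by simp
    field_simp
  · intro m hm
    simp [Nat.descFactorial_eq_zero_iff_lt.2 (Finset.mem_range.1 hm)]

theorem hasSum_pow_div_factorial_mul_Gamma_div_Gamma {a : ℝ} (ha : 0 < a) (y : ℝ) (j : ℕ) :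
    HasSum (fun m : ℕ => y ^ m / (m.factorial : ℝ) * (Gamma (a + m + j) / Gamma (a + m)))
      (Real.exp y * ∑ i ∈ Finset.range (j + 1),
        (j.choose i : ℝ) * (Gamma (a + j) / Gamma (a + i) * y ^ i)) := by
  have h := hasSum_sum (s := Finset.range (j + 1)) fun i _ =>
    (hasSum_pow_div_factorial_mul_descFactorial y i).mul_left
      ((j.choose i : ℝ) * (Gamma (a + j) / Gamma (a + i)))
  convert! h using 1
  · funext m
    rw [Gamma_add_add_div_Gamma_eq_sum ha, Finset.mul_sum]
    exact Finset.sum_congr rfl fun i _ => by ring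
  · rw [Finset.mul_sum]
    exact Finset.sum_congr rfl fun i _ => by ring

theorem sum_choose_mul_choose_mul_neg_two_pow (k i : ℕ) :
    ∑ j ∈ Finset.range (k + 1), (k.choose j : ℝ) * ((j.choose i : ℝ) * (-2) ^ j)
      = (-1) ^ k * 2 ^ i * (k.choose i : ℝ) := by
  induction k generalizing i with
  | zero => cases i <;> simp
  | succ k ih =>
    rw [sum_choose_mul_succ]
    cases i with
    | zero =>
      have h := ih 0
      simp only [Nat.choose_zero_right, Nat.cast_one, one_mul, pow_zero, mul_one] at h ⊢
      rw [pow_succ, ← h, Finset.sum_mul]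
      exact Finset.sum_congr rfl fun j _ => by ring
    | succ i =>
      have h : ∑ j ∈ Finset.range (k + 1), (k.choose j : ℝ) *
          (((j.choose (i + 1) : ℕ) : ℝ) * (-2) ^ j
            + (((j + 1).choose (i + 1) : ℕ) : ℝ) * (-2) ^ (j + 1))
          = -(∑ j ∈ Finset.range (k + 1), (k.choose j : ℝ) * ((j.choose (i + 1) : ℝ) * (-2) ^ j))
            - 2 * ∑ j ∈ Finset.range (k + 1), (k.choose j : ℝ) * ((j.choose i : ℝ) * (-2) ^ j) := by
        rw [Finset.mul_sum, ← Finset.sum_neg_distrib, ← Finset.sum_sub_distrib]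
        refine Finset.sum_congr rfl fun j _ => ?_
        rw [Nat.choose_succ_succ]
        push_cast
        ring
      rw [h, ih, ih, Nat.choose_succ_succ]
      push_cast
      ring

theorem sum_neg_two_pow_eq_laguerre {α : ℝ} (hα : -1 < α) (k : ℕ) (y : ℝ) :
    ∑ j ∈ Finset.range (k + 1),
      Gamma (α + k + 1) / (Gamma (α + j + 1) * ((k - j).factorial : ℝ) * (j.factorial : ℝ)) *
        (-2) ^ j * ∑ i ∈ Finset.range (j + 1),
          (j.choose i : ℝ) * (Gamma (α + 1 + j) / Gamma (α + 1 + i) * (-y) ^ i)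
      = (-1) ^ k * laguerre α k (2 * y) := by
  have gpos (n : ℕ) : 0 < Gamma (α + 1 + n) :=
    Gamma_pos_of_pos (by have : (0 : ℝ) ≤ n := n.cast_nonneg; linarith)
  have coeff {j : ℕ} (hj : j ∈ Finset.range (k + 1)) :
      (k.choose j : ℝ) = k.factorial / (((k - j).factorial : ℝ) * (j.factorial : ℝ)) := by
    rw [Nat.cast_choose ℝ (Nat.lt_succ_iff.1 (Finset.mem_range.1 hj)), mul_comm (_ : ℝ)]
  have hk : (k.factorial : ℝ) ≠ 0 := by positivity
  have comm (n : ℕ) : α + n + 1 = α + 1 + n := by ring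
  calc _ = ∑ j ∈ Finset.range (k + 1), ∑ i ∈ Finset.range (k + 1),
        Gamma (α + 1 + k) / k.factorial / Gamma (α + 1 + i) * (-y) ^ i *
          ((k.choose j : ℝ) * ((j.choose i : ℝ) * (-2) ^ j)) := by
        refine Finset.sum_congr rfl fun j hj => ?_
        have sub : Finset.range (j + 1) ⊆ Finset.range (k + 1) := by
          have := Finset.mem_range.1 hj
          exact Finset.range_subset_range.2 (by omega)
        rw [Finset.sum_subset sub, Finset.mul_sum]
        · refine Finset.sum_congr rfl fun i _ => ?_
          rw [coeff hj, comm, comm]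
          have := (gpos j).ne'
          have := (gpos i).ne'
          field_simp
        · intro i _ hi
          rw [Nat.choose_eq_zero_of_lt (by simpa using hi)]
          simp
    _ = ∑ i ∈ Finset.range (k + 1), Gamma (α + 1 + k) / k.factorial / Gamma (α + 1 + i) *
          (-y) ^ i * ((-1) ^ k * 2 ^ i * (k.choose i : ℝ)) := by
        rw [Finset.sum_comm]
        simp only [← Finset.mul_sum, sum_choose_mul_choose_mul_neg_two_pow]
    _ = _ := by
        rw [laguerre, Finset.mul_sum]
        refine Finset.sum_congr rfl fun i hi => ?_
        rw [coeff hi, comm, comm, show -(2 * y) = 2 * -y by ring, mul_pow]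
        have := (gpos i).ne'
        field_simp

theorem integral_rpow_mul_exp_neg_sq_div_two {s : ℝ} (hs : -1 < s) :
    ∫ r in Set.Ioi (0 : ℝ), r ^ (2 * s + 1) * Real.exp (-r ^ 2 / 2)
      = 2 ^ s * Gamma (s + 1) := by
  have h := integral_rpow_mul_exp_neg_mul_rpow (p := 2) (q := 2 * s + 1) (b := 1 / 2)
    (by norm_num) (by linarith) (by norm_num)
  have e (r : ℝ) : -(1 / 2) * r ^ (2 : ℝ) = -r ^ 2 / 2 := by rw [rpow_two]; ring
  simp only [e] at h
  rw [h, show -(2 * s + 1 + 1) / 2 = -(s + 1) by ring, show (2 * s + 1 + 1) / 2 = s + 1 by ring,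
    one_div, inv_rpow (by norm_num), rpow_neg (by norm_num), inv_inv, rpow_add_one (by norm_num)]
  ring

theorem integrableOn_rpow_mul_exp_neg_sq_div_two {s : ℝ} (hs : -1 < s) :
    IntegrableOn (fun r : ℝ => r ^ (2 * s + 1) * Real.exp (-r ^ 2 / 2)) (Set.Ioi 0) := by
  convert integrableOn_rpow_mul_exp_neg_mul_sq (b := 1 / 2) (s := 2 * s + 1)
    (by norm_num) (by linarith) using 5
  ring

/-- The coefficient of `r ^ (2 * m + α)` in the power series of `besselJ α (ρ * r)`. -/
noncomputable def besselCoeff (α ρ : ℝ) (m : ℕ) : ℝ :=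
  (-1) ^ m / ((m.factorial : ℝ) * Gamma ((m : ℝ) + α + 1)) * (ρ / 2) ^ (2 * m) * (ρ / 2) ^ α

theorem besselCoeff_mul_moment {α ρ : ℝ} (hρ : 0 < ρ) (m j : ℕ) :
    besselCoeff α ρ m * ((2 : ℝ) ^ (α + j + m) * Gamma (α + j + m + 1))
      = 2 ^ j * ρ ^ α * ((-(ρ ^ 2 / 2)) ^ m / (m.factorial : ℝ) *
          (Gamma (α + 1 + m + j) / Gamma (α + 1 + m))) := by
  have hρα : (ρ / 2) ^ α * 2 ^ α = ρ ^ α := by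
    rw [← mul_rpow (by positivity) (by norm_num), div_mul_cancel₀ _ two_ne_zero]
  have hy : (-(ρ ^ 2 / 2)) ^ m = (-1) ^ m * (ρ / 2) ^ (2 * m) * 2 ^ m := by
    rw [pow_mul, ← mul_pow, ← mul_pow]
    congr 1
    ring
  rw [besselCoeff, rpow_add two_pos, rpow_add two_pos, rpow_natCast, rpow_natCast, hy, ← hρα,
    show (m : ℝ) + α + 1 = α + 1 + m by ring, show α + j + m + 1 = α + 1 + m + j by ring]
  ring

theorem abs_besselCoeff_mul_moment {α ρ : ℝ} (hα : -1 < α) (hρ : 0 < ρ) (m j : ℕ) :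
    |besselCoeff α ρ m| * ((2 : ℝ) ^ (α + j + m) * Gamma (α + j + m + 1))
      = 2 ^ j * ρ ^ α * ((ρ ^ 2 / 2) ^ m / (m.factorial : ℝ) *
          (Gamma (α + 1 + m + j) / Gamma (α + 1 + m))) := by
  have ha : 0 < α + 1 := by linarith
  have h₁ : 0 < Gamma (α + 1 + m) := Gamma_pos_of_pos (by positivity)
  have h₂ : 0 < Gamma (α + 1 + m + j) := Gamma_pos_of_pos (by positivity)
  have h := congrArg abs (besselCoeff_mul_moment (α := α) hρ m j)
  have h₃ : α + j + m + 1 = α + 1 + m + j := by ring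
  rw [h₃] at h ⊢
  rw [abs_mul, abs_of_pos (by positivity : 0 < (2 : ℝ) ^ (α + j + m) * Gamma (α + 1 + m + j))] at h
  rw [h, abs_mul, abs_of_pos (by positivity : 0 < 2 ^ j * ρ ^ α), abs_mul, abs_div, abs_pow,
    abs_neg, abs_of_pos (by positivity : 0 < ρ ^ 2 / 2),
    abs_of_pos (by positivity : 0 < Gamma (α + 1 + m + j) / Gamma (α + 1 + m)), Nat.abs_cast]

theorem besselJ_mul_eq_tsum (α : ℝ) {ρ r : ℝ} (hρ : 0 < ρ) (hr : 0 < r) :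
    besselJ α (ρ * r) = ∑' m, besselCoeff α ρ m * (r ^ (2 * m) * r ^ α) := by
  refine tsum_congr fun m => ?_
  rw [besselCoeff, mul_div_right_comm, mul_pow, mul_rpow (by positivity) hr.le]
  ring

theorem rpow_mul_pow_mul_rpow {r : ℝ} (hr : 0 < r) (α : ℝ) (m j : ℕ) :
    r ^ (α + 1) * (r ^ 2) ^ j * (r ^ (2 * m) * r ^ α) = r ^ (2 * (α + j + m) + 1) := by
  rw [← pow_mul, ← rpow_natCast, ← rpow_natCast, ← rpow_add hr, ← rpow_add hr, ← rpow_add hr]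
  congr 1
  push_cast
  ring

theorem laguerre_hankel_invariance (α : ℝ) (hα : α > -1) (ρ : ℝ) (hρ : ρ > 0) (k : ℕ) :
    ∫ r in Set.Ioi (0 : ℝ),
        r ^ (α + 1) * laguerre α k (r ^ 2) * Real.exp (-r ^ 2 / 2) * besselJ α (ρ * r)
      = (-1 : ℝ) ^ k * ρ ^ α * laguerre α k (ρ ^ 2) * Real.exp (-ρ ^ 2 / 2) := by
  have ha : 0 < α + 1 := by linarith
  have hs (j m : ℕ) : -1 < α + j + m := by
    have : (0 : ℝ) ≤ j := j.cast_nonneg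
    have : (0 : ℝ) ≤ m := m.cast_nonneg
    linarith
  set c : ℕ → ℝ := fun j =>
    Gamma (α + k + 1) / (Gamma (α + j + 1) * ((k - j).factorial : ℝ) * (j.factorial : ℝ))
  set g : ℕ → ℕ → ℝ → ℝ := fun j m r =>
    r ^ (2 * (α + j + m) + 1) * Real.exp (-r ^ 2 / 2) with hg
  have g_int (j m : ℕ) : IntegrableOn (g j m) (Set.Ioi 0) :=
    integrableOn_rpow_mul_exp_neg_sq_div_two (hs j m)
  have g_val (j m : ℕ) : ∫ r in Set.Ioi 0, g j m r
      = (2 : ℝ) ^ (α + j + m) * Gamma (α + j + m + 1) :=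
    integral_rpow_mul_exp_neg_sq_div_two (hs j m)
  set F : ℕ → ℝ → ℝ := fun m r =>
    ∑ j ∈ Finset.range (k + 1), c j * (-1) ^ j * (besselCoeff α ρ m * g j m r) with hF
  have integrand_eq : Set.EqOn
      (fun r => r ^ (α + 1) * laguerre α k (r ^ 2) * Real.exp (-r ^ 2 / 2) * besselJ α (ρ * r))
      (fun r => ∑' m, F m r) (Set.Ioi 0) := by
    intro r hr
    simp only [besselJ_mul_eq_tsum α hρ hr, ← tsum_mul_left]
    refine tsum_congr fun m => ?_
    simp only [hF, hg, laguerre, Finset.mul_sum, Finset.sum_mul]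
    refine Finset.sum_congr rfl fun j _ => ?_
    rw [← rpow_mul_pow_mul_rpow hr, neg_pow (r ^ 2)]
    ring
  have F_int (m : ℕ) : IntegrableOn (F m) (Set.Ioi 0) :=
    integrable_finsetSum _ fun j _ => ((g_int j m).const_mul _).const_mul _
  have F_val (m : ℕ) : ∫ r in Set.Ioi 0, F m r = ∑ j ∈ Finset.range (k + 1),
      c j * (-2) ^ j * ρ ^ α * ((-(ρ ^ 2 / 2)) ^ m / (m.factorial : ℝ) *
        (Gamma (α + 1 + m + j) / Gamma (α + 1 + m))) := by
    rw [integral_finsetSum _ fun j _ => ((g_int j m).const_mul _).const_mul _]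
    refine Finset.sum_congr rfl fun j _ => ?_
    rw [integral_const_mul, integral_const_mul, g_val, besselCoeff_mul_moment hρ,
      neg_pow (2 : ℝ)]
    ring
  have F_norm (m : ℕ) : ∫ r in Set.Ioi 0, ‖F m r‖ ≤ ∑ j ∈ Finset.range (k + 1),
      |c j| * 2 ^ j * ρ ^ α * ((ρ ^ 2 / 2) ^ m / (m.factorial : ℝ) *
        (Gamma (α + 1 + m + j) / Gamma (α + 1 + m))) := by
    have bound_int (j : ℕ) : IntegrableOn
        (fun r => |c j| * (|besselCoeff α ρ m| * g j m r)) (Set.Ioi 0) :=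
      ((g_int j m).const_mul _).const_mul _
    calc ∫ r in Set.Ioi 0, ‖F m r‖
        ≤ ∫ r in Set.Ioi 0, ∑ j ∈ Finset.range (k + 1),
            |c j| * (|besselCoeff α ρ m| * g j m r) := by
          refine setIntegral_mono_on (F_int m).norm
            (integrable_finsetSum _ fun j _ => bound_int j) measurableSet_Ioi fun r hr => ?_
          refine (norm_sum_le _ _).trans (Finset.sum_le_sum fun j _ => le_of_eq ?_)
          have hr' : 0 < r := hr
          have : 0 ≤ g j m r := by simp only [hg]; positivity
          simp [abs_of_nonneg this]
      _ = _ := by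
          rw [integral_finsetSum _ fun j _ => bound_int j]
          refine Finset.sum_congr rfl fun j _ => ?_
          rw [integral_const_mul, integral_const_mul, g_val, abs_besselCoeff_mul_moment hα hρ]
          ring
  have F_summable : Summable fun m => ∫ r in Set.Ioi 0, ‖F m r‖ :=
    Summable.of_nonneg_of_le (fun m => integral_nonneg fun r => norm_nonneg _) F_norm
      (summable_sum fun j _ =>
        (hasSum_pow_div_factorial_mul_Gamma_div_Gamma ha _ j).summable.mul_left _)
  have h₁ := hasSum_integral_of_summable_integral_norm F_int F_summable
  simp only [F_val] at h₁
  have h₂ := hasSum_sum (s := Finset.range (k + 1)) fun j _ =>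
    (hasSum_pow_div_factorial_mul_Gamma_div_Gamma ha (-(ρ ^ 2 / 2)) j).mul_left
      (c j * (-2) ^ j * ρ ^ α)
  rw [setIntegral_congr_fun measurableSet_Ioi integrand_eq, h₁.unique h₂]
  have h₃ := sum_neg_two_pow_eq_laguerre hα k (ρ ^ 2 / 2)
  rw [show 2 * (ρ ^ 2 / 2) = ρ ^ 2 by ring] at h₃
  rw [mul_right_comm _ (ρ ^ α), ← h₃, Finset.sum_mul, Finset.sum_mul, neg_div]
  exact Finset.sum_congr rfl fun j _ => by ring
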